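/- There exist vectors ζ, η ∈ ℤ³ with aζ₁ + bζ₂ + cζ₃ = 0, aη₁ + bη₂ + cη₃ = 0, ζ·ζ = 2d², η·η = 2d², and ζ·η = d², such that for all P, Q ∈ P_{a,b,c} with P ≠ Q: the triangle with vertices 0, P, Q is equilateral (i.e., ‖P‖ = ‖Q‖ = ‖P − Q‖) if and only if there exist integers m, n with {P, Q} = {m·ζ − n·η, n·ζ + (m − n)·η} as an unordered pair. -/

import Mathlib

section EquilateralLattice

open scoped Matrix

/-- `Q` is the image of `P` under the rotation by `π / 3` about the axis spanned by `N`, where `P`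
is orthogonal to `N` and `N` has Euclidean norm `√3 d`. -/
def IsRotSixth (N : Fin 3 → ℤ) (d : ℤ) (P Q : Fin 3 → ℤ) : Prop :=
  N ⬝ᵥ P = 0 ∧ (2 * d) • Q = d • P + N ⨯₃ P

/-- Expansion of a vector of the plane orthogonal to `N` along `Z` and `N ⨯₃ Z`. -/
theorem smul_eq_smul_add_smul_cross {N P Z : Fin 3 → ℤ} (hP : N ⬝ᵥ P = 0) (hZ : N ⬝ᵥ Z = 0) :
    ((N ⬝ᵥ N) * (Z ⬝ᵥ Z)) • P
      = ((N ⬝ᵥ N) * (P ⬝ᵥ Z)) • Z + (P ⬝ᵥ (N ⨯₃ Z)) • (N ⨯₃ Z) := by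
  simp only [dotProduct, Fin.sum_univ_three, cross_apply] at *
  ext i
  fin_cases i <;> simp <;> grind

variable {N P Q P' Q' : Fin 3 → ℤ} {d : ℤ}

namespace IsRotSixth

theorem combo (h : IsRotSixth N d P Q) (h' : IsRotSixth N d P' Q') (m n : ℤ) :
    IsRotSixth N d (m • P + n • P') (m • Q + n • Q') := by
  obtain ⟨h1, h2⟩ := h
  obtain ⟨h1', h2'⟩ := h'
  refine ⟨by rw [dotProduct_add, dotProduct_smul, dotProduct_smul, h1, h1', smul_zero, smul_zero,
    add_zero], ?_⟩
  simp only [smul_add, map_add, map_smul, smul_comm (2 * d), h2, h2', smul_comm d]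
  abel

theorem dot_right (h : IsRotSixth N d P Q) (hd : d ≠ 0) : N ⬝ᵥ Q = 0 := by
  have h2 := congrArg (N ⬝ᵥ ·) h.2
  simp only [dotProduct_add, dotProduct_smul, h.1, dot_self_cross, smul_eq_mul, mul_zero, add_zero,
    mul_eq_zero, hd, two_ne_zero, or_self, false_or] at h2
  exact h2

theorem next (h : IsRotSixth N d P Q) (hN : N ⬝ᵥ N = 3 * d ^ 2) (hd : d ≠ 0) :
    IsRotSixth N d Q (Q - P) := by
  refine ⟨h.dot_right hd, ?_⟩
  have hcc : N ⨯₃ (N ⨯₃ P) = -(3 * d ^ 2) • P := by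
    rw [cross_cross_eq_smul_sub_smul', h.1, hN]; simp
  have hc : (2 * d) • (N ⨯₃ Q) = d • (N ⨯₃ P) + N ⨯₃ (N ⨯₃ P) := by
    rw [← map_smul, h.2, map_add, map_smul]
  rw [hcc] at hc
  have h2 := h.2
  ext i
  have e1 := congrFun h2 i
  have e2 := congrFun hc i
  simp only [Pi.smul_apply, Pi.add_apply, Pi.sub_apply, smul_eq_mul] at *
  apply mul_left_cancel₀ (mul_ne_zero two_ne_zero hd)
  linear_combination d * e1 - e2

theorem two_mul_dot (h : IsRotSixth N d P Q) (hd : d ≠ 0) : 2 * (P ⬝ᵥ Q) = P ⬝ᵥ P := by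
  have h2 := congrArg (P ⬝ᵥ ·) h.2
  simp only [dotProduct_add, dotProduct_smul, smul_eq_mul, dot_cross_self] at h2
  apply mul_left_cancel₀ hd
  linear_combination h2

theorem dot_self_right (h : IsRotSixth N d P Q) (hN : N ⬝ᵥ N = 3 * d ^ 2) (hd : d ≠ 0) :
    Q ⬝ᵥ Q = P ⬝ᵥ P := by
  have h1 := (h.next hN hd).two_mul_dot hd
  have h2 := h.two_mul_dot hd
  rw [dotProduct_sub, dotProduct_comm Q P] at h1
  linarith

/-- The vectors `P` with integral rotation are congruent to multiples of `N` modulo `d`. -/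
theorem sq_dvd_dot_self (h : IsRotSixth N d P Q) (hN : N ⬝ᵥ N = 3 * d ^ 2)
    {u : Fin 3 → ℤ} (hu : u ⬝ᵥ N = 1) : d ^ 2 ∣ P ⬝ᵥ P := by
  obtain ⟨h1, h2⟩ := h
  have hc : N ⨯₃ P = d • ((2 : ℤ) • Q - P) := by
    rw [smul_sub, smul_smul, mul_comm d 2, h2]; abel
  have hP : P = (u ⬝ᵥ P) • N - d • (u ⨯₃ ((2 : ℤ) • Q - P)) := by
    rw [← map_smul, ← hc, cross_cross_eq_smul_sub_smul', dotProduct_comm N u, hu]; simp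
  generalize u ⬝ᵥ P = l at hP
  generalize u ⨯₃ ((2 : ℤ) • Q - P) = W at hP
  subst hP
  simp only [dotProduct_sub, sub_dotProduct, dotProduct_smul, smul_dotProduct, smul_eq_mul,
    hN, dotProduct_comm W N] at h1 ⊢
  exact ⟨W ⬝ᵥ W - 3 * l ^ 2, by linear_combination 2 * l * h1⟩

/-- Every vector of the lattice is an integral combination of a shortest vector and its rotation. -/
theorem exists_combo {Z H : Fin 3 → ℤ} (hZ : IsRotSixth N d Z H) (hN : N ⬝ᵥ N = 3 * d ^ 2)
    (hd : d ≠ 0) (hpos : 0 < Z ⬝ᵥ Z)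
    (hmin : ∀ P Q, IsRotSixth N d P Q → 0 < P ⬝ᵥ P → Z ⬝ᵥ Z ≤ P ⬝ᵥ P)
    (h : IsRotSixth N d P Q) : ∃ m n : ℤ, P = m • Z + n • H := by
  have hHH := hZ.dot_self_right hN hd
  have hZH := hZ.two_mul_dot hd
  set k := Z ⬝ᵥ Z with hk
  have hexp : (3 * k) • P
      = (4 * (P ⬝ᵥ Z) - 2 * (P ⬝ᵥ H)) • Z + (4 * (P ⬝ᵥ H) - 2 * (P ⬝ᵥ Z)) • H := by
    have e := smul_eq_smul_add_smul_cross h.1 hZ.1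
    have hc : N ⨯₃ Z = d • ((2 : ℤ) • H - Z) := by
      rw [smul_sub, smul_smul, mul_comm d 2, hZ.2]; abel
    rw [hc, hN, ← hk] at e
    ext i
    have ei := congrFun e i
    simp only [dotProduct_smul, dotProduct_sub, Pi.smul_apply, Pi.add_apply, Pi.sub_apply,
      smul_eq_mul] at ei ⊢
    apply mul_left_cancel₀ (pow_ne_zero 2 hd)
    linear_combination ei
  have round : ∀ t : ℤ, ∃ m r : ℤ, t = 3 * k * m + r ∧ 2 * r ≤ 3 * k ∧ -(3 * k) ≤ 2 * r := by
    intro t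
    have e := Int.mul_ediv_add_emod (2 * t + 3 * k) (6 * k)
    have l := Int.emod_nonneg (2 * t + 3 * k) (show 6 * k ≠ 0 by positivity)
    have g := Int.emod_lt_of_pos (2 * t + 3 * k) (show 0 < 6 * k by positivity)
    exact ⟨(2 * t + 3 * k) / (6 * k), t - 3 * k * ((2 * t + 3 * k) / (6 * k)), by ring,
      by linarith, by linarith⟩
  obtain ⟨m, r, hm, hr, hr'⟩ := round (4 * (P ⬝ᵥ Z) - 2 * (P ⬝ᵥ H))
  obtain ⟨n, s, hn, hs, hs'⟩ := round (4 * (P ⬝ᵥ H) - 2 * (P ⬝ᵥ Z))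
  rw [hm, hn] at hexp
  refine ⟨m, n, ?_⟩
  have hD := h.combo (hZ.combo (hZ.next hN hd) m n) 1 (-1)
  set D := (1 : ℤ) • P + (-1 : ℤ) • (m • Z + n • H) with hDdef
  have hDexp : (3 * k) • D = r • Z + s • H := by
    rw [hDdef, smul_add, one_smul, hexp]; module
  have hDD : 9 * k * (D ⬝ᵥ D) = r ^ 2 + r * s + s ^ 2 := by
    have e := congrArg (fun v ↦ v ⬝ᵥ v) hDexp
    simp only [dotProduct_add, add_dotProduct, dotProduct_smul, smul_dotProduct, smul_eq_mul,
      dotProduct_comm H Z, hHH, ← hk] at e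
    apply mul_left_cancel₀ hpos.ne'
    linear_combination e + r * s * hZH
  have hlt : D ⬝ᵥ D < k := by
    have h1 : 4 * (r ^ 2 + r * s + s ^ 2) ≤ 27 * k ^ 2 := by nlinarith
    nlinarith
  have h0 : 0 ≤ D ⬝ᵥ D := by
    simp only [dotProduct, Fin.sum_univ_three]
    nlinarith [sq_nonneg (D 0), sq_nonneg (D 1), sq_nonneg (D 2)]
  have hDz : D = 0 := by
    by_contra hne
    have : D ⬝ᵥ D ≠ 0 := fun h ↦ hne (dotProduct_self_eq_zero.1 h)
    exact absurd (hmin _ _ hD (by omega)) (by omega)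
  have : P = D + (m • Z + n • H) := by rw [hDdef]; module
  rw [this, hDz, zero_add]

end IsRotSixth

/-- An equilateral triangle with a vertex at the origin in the plane orthogonal to `N` is given by
the rotation in one of the two orders of its other vertices. -/
theorem isRotSixth_or_isRotSixth (hN : N ⬝ᵥ N = 3 * d ^ 2) (hd : d ≠ 0) (hP : N ⬝ᵥ P = 0)
    (hQ : N ⬝ᵥ Q = 0) (hPQ : 2 * (P ⬝ᵥ Q) = P ⬝ᵥ P) (hPP : Q ⬝ᵥ Q = P ⬝ᵥ P) (hne : P ⬝ᵥ P ≠ 0) :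
    IsRotSixth N d P Q ∨ IsRotSixth N d Q P := by
  set E := (2 : ℤ) • Q - P with hE
  have hNE : N ⬝ᵥ E = 0 := by
    rw [hE, dotProduct_sub, dotProduct_smul, hP, hQ, smul_zero, sub_zero]
  have hEP : E ⬝ᵥ P = 0 := by
    simp only [hE, sub_dotProduct, smul_dotProduct, smul_eq_mul, dotProduct_comm Q P]
    linarith
  have hEE : E ⬝ᵥ E = 3 * (P ⬝ᵥ P) := by
    simp only [hE, sub_dotProduct, dotProduct_sub, dotProduct_smul, smul_dotProduct, smul_eq_mul,
      dotProduct_comm Q P]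
    linarith
  have hexp := smul_eq_smul_add_smul_cross hNE hP
  rw [hEP, mul_zero, zero_smul, zero_add, hN] at hexp
  set e := E ⬝ᵥ (N ⨯₃ P) with he
  have hsq : e ^ 2 = (3 * d * (P ⬝ᵥ P)) ^ 2 := by
    have h := congrArg (E ⬝ᵥ ·) hexp
    simp only [dotProduct_smul, smul_eq_mul, hEE, ← he] at h
    linear_combination -h
  have key : d • E = N ⨯₃ P ∨ d • E = -(N ⨯₃ P) := by
    have hc : 3 * d * (P ⬝ᵥ P) ≠ 0 := by positivity
    rcases sq_eq_sq_iff_eq_or_eq_neg.1 hsq with h | h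
    · left
      apply smul_right_injective _ hc
      simp only [← h, ← hexp, smul_smul]
      rw [h]; congr 1; ring
    · right
      apply smul_right_injective _ hc
      simp only [smul_neg, ← neg_smul, ← h, ← hexp, smul_smul]
      congr 1; ring
  rcases key with h | h
  · exact .inl ⟨hP, by rw [← h, hE]; module⟩
  · right
    have hneg : IsRotSixth N d P (P - Q) := ⟨hP, by
      rw [← neg_eq_iff_eq_neg.2 h, hE]; module⟩
    have hcombo := hneg.combo (hneg.next hN hd) 1 (-1)
    have e1 : (1 : ℤ) • P + (-1 : ℤ) • (P - Q) = Q := by module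
    have e2 : (1 : ℤ) • (P - Q) + (-1 : ℤ) • (P - Q - P) = P := by module
    rwa [e1, e2] at hcombo

theorem exists_mul_add_mul_add_mul_eq_one {a b c : ℤ}
    (hgcd : Int.gcd (Int.gcd a b : ℤ) c = 1) : ∃ u v w : ℤ, u * a + v * b + w * c = 1 := by
  have e1 := Int.gcd_eq_gcd_ab a b
  have e2 := Int.gcd_eq_gcd_ab (Int.gcd a b : ℤ) c
  rw [hgcd, Nat.cast_one] at e2
  exact ⟨a.gcdA b * (Int.gcd a b : ℤ).gcdA c, a.gcdB b * (Int.gcd a b : ℤ).gcdA c,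
    (Int.gcd a b : ℤ).gcdB c, by linear_combination -e2 - (Int.gcd a b : ℤ).gcdA c * e1⟩

/-- All entries of a primitive solution of `a ^ 2 + b ^ 2 + c ^ 2 = 3 * d ^ 2` are odd. -/
theorem odd_of_sq_add_sq_add_sq_eq {a b c d : ℤ} (hgcd : Int.gcd (Int.gcd a b : ℤ) c = 1)
    (hsum : a ^ 2 + b ^ 2 + c ^ 2 = 3 * d ^ 2) : Odd a ∧ Odd b ∧ Odd c ∧ Odd d := by
  have key : ∀ x : ℤ, x ^ 2 % 4 = x % 2 := by
    intro x
    rcases Int.even_or_odd' x with ⟨y, rfl | rfl⟩ <;> ring_nf <;> omega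
  have ha := key a
  have hb := key b
  have hc := key c
  have hd := key d
  have hne : ¬(2 ∣ a ∧ 2 ∣ b ∧ 2 ∣ c) := fun ⟨h1, h2, h3⟩ ↦ by
    have := Int.dvd_coe_gcd (Int.dvd_coe_gcd h1 h2) h3
    rw [hgcd] at this
    norm_num at this
  simp only [Int.odd_iff]
  generalize a ^ 2 = x at *
  generalize b ^ 2 = y at *
  generalize c ^ 2 = z at *
  generalize d ^ 2 = w at *
  rcases Int.emod_two_eq a with h1 | h1 <;> rcases Int.emod_two_eq b with h2 | h2 <;>
    rcases Int.emod_two_eq c with h3 | h3 <;> rcases Int.emod_two_eq d with h4 | h4 <;> omega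

theorem exists_two_smul_eq (hN : ∀ i, Odd (N i)) (hd : Odd d) (hP : N ⬝ᵥ P = 0) :
    ∃ Q : Fin 3 → ℤ, (2 : ℤ) • Q = d • P + N ⨯₃ P := by
  obtain ⟨a, ha⟩ := hN 0
  obtain ⟨b, hb⟩ := hN 1
  obtain ⟨c, hc⟩ := hN 2
  obtain ⟨e, he⟩ := hd
  simp only [dotProduct, Fin.sum_univ_three, ha, hb, hc] at hP
  refine ⟨![e * P 0 + b * P 2 - c * P 1 - P 1 - (a * P 0 + b * P 1 + c * P 2),
    e * P 1 + c * P 0 - a * P 2 - P 2 - (a * P 0 + b * P 1 + c * P 2),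
    e * P 2 + a * P 1 - b * P 0 - P 0 - (a * P 0 + b * P 1 + c * P 2)], ?_⟩
  ext i
  fin_cases i <;> simp [cross_apply, ha, hb, hc, he] <;> linear_combination -hP

theorem exists_isRotSixth_dot_self (hN : N ⬝ᵥ N = 3 * d ^ 2) (hd : d ≠ 0)
    (hNodd : ∀ i, Odd (N i)) (hdodd : Odd d) (hP : N ⬝ᵥ P = 0) :
    ∃ Z H, IsRotSixth N d Z H ∧ Z ⬝ᵥ Z = d ^ 2 * (P ⬝ᵥ P) := by
  obtain ⟨Z, hZ⟩ := exists_two_smul_eq hNodd hdodd hP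
  have hrot : IsRotSixth N d (d • P) Z :=
    ⟨by rw [dotProduct_smul, hP, smul_zero], by
      rw [map_smul, mul_comm, ← smul_smul, hZ, smul_add]⟩
  refine ⟨Z, _, hrot.next hN hd, ?_⟩
  rw [hrot.dot_self_right hN hd]
  simp only [dotProduct_smul, smul_dotProduct, smul_eq_mul]
  ring

end EquilateralLattice


theorem stmt_5 (a b c d : ℤ)
    (hgcd : Int.gcd (Int.gcd a b : ℤ) c = 1)
    (hsum : a ^ 2 + b ^ 2 + c ^ 2 = 3 * d ^ 2)
    (hd : 1 ≤ d) (hab : ¬(a = 0 ∧ b = 0)) :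
    ∃ ζ η : Fin 3 → ℤ,
      a * ζ 0 + b * ζ 1 + c * ζ 2 = 0 ∧
      a * η 0 + b * η 1 + c * η 2 = 0 ∧
      (∑ i, ζ i * ζ i) = 2 * d ^ 2 ∧
      (∑ i, η i * η i) = 2 * d ^ 2 ∧
      (∑ i, ζ i * η i) = d ^ 2 ∧
      ∀ P Q : Fin 3 → ℤ,
        a * P 0 + b * P 1 + c * P 2 = 0 →
        a * Q 0 + b * Q 1 + c * Q 2 = 0 →
        P ≠ Q →
        (((∑ i, P i ^ 2) = (∑ i, Q i ^ 2) ∧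
          (∑ i, Q i ^ 2) = (∑ i, (P i - Q i) ^ 2)) ↔
         ∃ m n : ℤ, ({P, Q} : Set (Fin 3 → ℤ)) =
            {m • ζ - n • η, n • ζ + (m - n) • η}) := by
  obtain ⟨oa, ob, oc, od⟩ := odd_of_sq_add_sq_add_sq_eq hgcd hsum
  have hd0 : d ≠ 0 := by omega
  set N : Fin 3 → ℤ := ![a, b, c] with hNdef
  have hdotN : ∀ P : Fin 3 → ℤ, dotProduct N P = a * P 0 + b * P 1 + c * P 2 := by
    intro P; simp [dotProduct, Fin.sum_univ_three, hNdef]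
  have hN : dotProduct N N = 3 * d ^ 2 := by
    rw [hdotN, ← hsum]; simp [hNdef]; ring
  have hNodd : ∀ i, Odd (N i) := by
    intro i; fin_cases i <;> simpa [hNdef]
  have hPP : ∀ x y z : ℤ, a * x + b * y + c * z = 0 →
      ∃ Z H, IsRotSixth N d Z H ∧ dotProduct Z Z = d ^ 2 * (x ^ 2 + y ^ 2 + z ^ 2) := by
    intro x y z h
    obtain ⟨Z, H, h1, h2⟩ := exists_isRotSixth_dot_self hN hd0 hNodd od
      (P := ![x, y, z]) (by rw [hdotN]; simpa using h)
    exact ⟨Z, H, h1, by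
      rw [h2]; simp only [dotProduct, Fin.sum_univ_three, Matrix.cons_val]; ring⟩
  obtain ⟨u, hu⟩ : ∃ u : Fin 3 → ℤ, dotProduct u N = 1 := by
    obtain ⟨x, y, z, h⟩ := exists_mul_add_mul_add_mul_eq_one hgcd
    exact ⟨![x, y, z], by rw [dotProduct_comm, hdotN, ← h]; simp; ring⟩
  obtain ⟨Z, H, hZ, hpos, hmin⟩ : ∃ Z H, IsRotSixth N d Z H ∧ 0 < dotProduct Z Z ∧
      ∀ P Q, IsRotSixth N d P Q → 0 < dotProduct P P → dotProduct Z Z ≤ dotProduct P P := by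
    classical
    have hex : ∃ n : ℕ, ∃ Z H, IsRotSixth N d Z H ∧ 0 < dotProduct Z Z ∧
        dotProduct Z Z = n := by
      obtain ⟨Z, H, h1, h2⟩ := hPP b (-a) 0 (by ring)
      have h0 : 0 < dotProduct Z Z := by
        have : a ≠ 0 := by rintro rfl; simp at oa
        have ha : 0 < a ^ 2 := by positivity
        rw [h2]; exact mul_pos (by positivity) (by nlinarith [sq_nonneg b])
      exact ⟨(dotProduct Z Z).toNat, Z, H, h1, h0, by omega⟩
    obtain ⟨Z, H, h1, h2, h3⟩ := Nat.find_spec hex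
    refine ⟨Z, H, h1, h2, fun P Q h h' ↦ ?_⟩
    have := Nat.find_min' hex ⟨P, Q, h, h', (Int.toNat_of_nonneg h'.le).symm⟩
    omega
  have hHH := hZ.dot_self_right hN hd0
  have hZH := hZ.two_mul_dot hd0
  have hdvd : ∀ P Q, IsRotSixth N d P Q → dotProduct Z Z ∣ dotProduct P P := by
    intro P Q h
    obtain ⟨m, n, rfl⟩ := hZ.exists_combo hN hd0 hpos hmin h
    refine ⟨m ^ 2 + m * n + n ^ 2, ?_⟩
    simp only [dotProduct_add, add_dotProduct, dotProduct_smul, smul_dotProduct, smul_eq_mul,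
      dotProduct_comm H Z, hHH]
    linear_combination m * n * hZH
  have hk : dotProduct Z Z = 2 * d ^ 2 := by
    apply Int.dvd_antisymm hpos.le (by positivity)
    · have hv : ∀ x y z, a * x + b * y + c * z = 0 →
          dotProduct Z Z ∣ d ^ 2 * (x ^ 2 + y ^ 2 + z ^ 2) := by
        intro x y z h
        obtain ⟨P, Q, h1, h2⟩ := hPP x y z h
        exact h2 ▸ hdvd P Q h1
      obtain ⟨p, hp⟩ := hv b (-a) 0 (by ring)
      obtain ⟨q, hq⟩ := hv c 0 (-a) (by ring)
      obtain ⟨r, hr⟩ := hv 0 c (-b) (by ring)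
      have h1 : dotProduct Z Z ∣ 2 * d ^ 2 * a ^ 2 :=
        ⟨p + q - r, by linear_combination hp + hq - hr⟩
      have h2 : dotProduct Z Z ∣ 2 * d ^ 2 * b ^ 2 :=
        ⟨p + r - q, by linear_combination hp + hr - hq⟩
      have h3 : dotProduct Z Z ∣ 2 * d ^ 2 * c ^ 2 :=
        ⟨q + r - p, by linear_combination hq + hr - hp⟩
      have hg : Int.gcd (Int.gcd (a ^ 2) (b ^ 2) : ℤ) (c ^ 2) = 1 := by
        rw [Int.pow_gcd_pow, Nat.cast_pow, Int.pow_gcd_pow, hgcd, one_pow]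
      obtain ⟨x, y, z, h⟩ := exists_mul_add_mul_add_mul_eq_one hg
      have e : 2 * d ^ 2
          = x * (2 * d ^ 2 * a ^ 2) + y * (2 * d ^ 2 * b ^ 2) + z * (2 * d ^ 2 * c ^ 2) := by
        linear_combination -2 * d ^ 2 * h
      rw [e]
      exact ((h1.mul_left x).add (h2.mul_left y)).add (h3.mul_left z)
    · have h1 := hZ.sq_dvd_dot_self hN hu
      have h2 : (2 : ℤ) ∣ dotProduct Z Z := ⟨_, hZH.symm⟩
      have hco : IsCoprime (2 : ℤ) (d ^ 2) :=
        (Int.isCoprime_iff_gcd_eq_one.2 (by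
          simpa [Int.gcd_comm] using Int.isCoprime_iff_gcd_eq_one.1
            (Int.isCoprime_two_left.2 od))).pow_right
      exact hco.mul_dvd h2 h1
  rw [hk] at hHH hZH
  have hsd : ∀ P Q : Fin 3 → ℤ, ∑ i, (P i - Q i) ^ 2
      = dotProduct P P - 2 * dotProduct P Q + dotProduct Q Q := by
    intro P Q; simp only [dotProduct, Fin.sum_univ_three]; ring
  have hs : ∀ P : Fin 3 → ℤ, ∑ i, P i ^ 2 = dotProduct P P := by
    intro P; simp only [dotProduct, sq]
  refine ⟨Z, H, hdotN Z ▸ hZ.1, hdotN H ▸ hZ.dot_right hd0, hk, hHH,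
    by change dotProduct Z H = _; linarith, ?_⟩
  intro P Q hP hQ hne
  rw [← hdotN] at hP hQ
  rw [hs, hs, hsd]
  have hrot : ∀ m n : ℤ, IsRotSixth N d (m • Z - n • H) (n • Z + (m - n) • H) := by
    intro m n
    have h := hZ.combo (hZ.next hN hd0) m (-n)
    convert h using 1 <;> module
  have gen : ∀ P Q, IsRotSixth N d P Q →
      ∃ m n : ℤ, P = m • Z - n • H ∧ Q = n • Z + (m - n) • H := by
    intro P Q h
    obtain ⟨m, n, hmn⟩ := hZ.exists_combo hN hd0 hpos hmin h
    have e : P = m • Z - (-n) • H := by rw [hmn]; module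
    refine ⟨m, -n, e, ?_⟩
    have h2 := (hrot m (-n)).2
    rw [← e, ← h.2] at h2
    exact (smul_right_injective _ (mul_ne_zero two_ne_zero hd0) h2).symm
  constructor
  · rintro ⟨h1, h2⟩
    have hP0 : dotProduct P P ≠ 0 := by
      intro h0
      apply hne
      have h0' : dotProduct Q Q = 0 := h1 ▸ h0
      rw [dotProduct_self_eq_zero.1 h0, dotProduct_self_eq_zero.1 h0']
    rcases isRotSixth_or_isRotSixth hN hd0 hP hQ (by linarith) h1.symm hP0 with h | h
    · obtain ⟨m, n, rfl, rfl⟩ := gen _ _ h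
      exact ⟨m, n, rfl⟩
    · obtain ⟨m, n, rfl, rfl⟩ := gen _ _ h
      exact ⟨m, n, Set.pair_comm _ _⟩
  · rintro ⟨m, n, h⟩
    have h1 := (hrot m n).dot_self_right hN hd0
    have h2 := (hrot m n).two_mul_dot hd0
    rcases Set.pair_eq_pair_iff.1 h with ⟨rfl, rfl⟩ | ⟨rfl, rfl⟩
    · exact ⟨h1.symm, by linarith⟩
    · rw [dotProduct_comm (n • Z + (m - n) • H) (m • Z - n • H)]
      exact ⟨h1, by linarith⟩
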